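/- Let (T_0, T_1, …, T_M) be an exchangeable random vector of real-valued random variables, i.e., its joint distribution is invariant under every permutation of the M+1 coordinates. Define P = (1 + #{m ∈ {1,…,M} : T_m ≥ T_0}) / (1 + M). Then for every α ∈ [0,1], ℙ{P ≤ α} ≤ α. -/

import Mathlib

open MeasureTheory

/-- The upper rank of the coordinate `i` of `x`: the number of coordinates that are at least `x i`,
`i` itself included. -/
noncomputable def upperRank {ι : Type*} [Fintype ι] (x : ι → ℝ) (i : ι) : ℕ :=
  (Finset.univ.filter (fun m => x i ≤ x m)).card

/-- At most `c` coordinates have upper rank at most `c`. -/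
lemma card_upperRank_le {ι : Type*} [Fintype ι] (x : ι → ℝ) {c : ℝ} (hc : 0 ≤ c) :
    ((Finset.univ.filter (fun i => (upperRank x i : ℝ) ≤ c)).card : ℝ) ≤ c := by
  rcases (Finset.univ.filter (fun i => (upperRank x i : ℝ) ≤ c)).eq_empty_or_nonempty with h | h
  · simpa [h] using hc
  · obtain ⟨i, hi, hmin⟩ := Finset.exists_min_image _ x h
    refine le_trans ?_ (Finset.mem_filter.1 hi).2
    exact_mod_cast Finset.card_le_card fun m hm =>
      Finset.mem_filter.2 ⟨Finset.mem_univ m, hmin m hm⟩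

lemma measurable_upperRank {ι : Type*} [Fintype ι] (i : ι) :
    Measurable (fun x : ι → ℝ => (upperRank x i : ℝ)) := by
  simp only [upperRank, Finset.card_filter, Nat.cast_sum]
  refine Finset.measurable_sum _ fun m _ => ?_
  simp only [Nat.cast_ite]
  exact Measurable.ite (measurableSet_le (measurable_pi_apply i) (measurable_pi_apply m))
    measurable_const measurable_const

lemma upperRank_comp_perm {ι : Type*} [Fintype ι] (x : ι → ℝ) (π : Equiv.Perm ι) (i : ι) :
    upperRank (fun m => x (π m)) i = upperRank x (π i) := by
  refine Finset.card_bij (fun m _ => π m) (by simp) (fun _ _ _ _ h => π.injective h) fun m hm => ?_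
  exact ⟨π.symm m, by simpa using hm, by simp⟩

lemma upperRank_zero {M : ℕ} (x : Fin (M + 1) → ℝ) :
    upperRank x 0 = 1 + (Finset.univ.filter (fun m : Fin M => x 0 ≤ x m.succ)).card := by
  rw [upperRank, Fin.card_filter_univ_succ, if_pos le_rfl, add_comm]

/-- In an exchangeable family, the upper rank of each coordinate is stochastically at least as large
as a uniform variable on `{1, …, card ι}`. -/
lemma card_mul_measure_upperRank_le {ι Ω : Type*} [Fintype ι] [MeasurableSpace Ω]
    (μ : Measure Ω) [IsProbabilityMeasure μ] {T : Ω → ι → ℝ} (hT : Measurable T)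
    (hexch : ∀ π : Equiv.Perm ι, Measure.map (fun ω => fun m => T ω (π m)) μ = Measure.map T μ)
    (i : ι) {c : ℝ} (hc : 0 ≤ c) :
    (Fintype.card ι : ENNReal) * μ {ω | (upperRank (T ω) i : ℝ) ≤ c} ≤ ENNReal.ofReal c := by
  classical
  have hmeas (j : ι) : MeasurableSet {x : ι → ℝ | (upperRank x j : ℝ) ≤ c} :=
    measurableSet_le (measurable_upperRank j) measurable_const
  have hperm (j : ι) :
      μ {ω | (upperRank (T ω) j : ℝ) ≤ c} = μ {ω | (upperRank (T ω) i : ℝ) ≤ c} := by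
    have hTπ : Measurable (fun ω => fun m => T ω (Equiv.swap i j m)) :=
      measurable_pi_lambda _ fun m => (measurable_pi_apply _).comp hT
    have h := congrArg (fun ν => ν {x : ι → ℝ | (upperRank x i : ℝ) ≤ c}) (hexch (Equiv.swap i j))
    simpa [Measure.map_apply hTπ (hmeas i), Measure.map_apply hT (hmeas i), Set.preimage,
      upperRank_comp_perm] using h
  calc (Fintype.card ι : ENNReal) * μ {ω | (upperRank (T ω) i : ℝ) ≤ c}
      = ∑ j, μ {ω | (upperRank (T ω) j : ℝ) ≤ c} := by simp [hperm]
    _ = ∑ j, ∫⁻ ω, {ω | (upperRank (T ω) j : ℝ) ≤ c}.indicator 1 ω ∂μ :=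
        Finset.sum_congr rfl fun j _ => (lintegral_indicator_one (hT (hmeas j))).symm
    _ = ∫⁻ ω, ∑ j, {ω | (upperRank (T ω) j : ℝ) ≤ c}.indicator 1 ω ∂μ :=
        (lintegral_finsetSum _ fun j _ => measurable_one.indicator (hT (hmeas j))).symm
    _ ≤ ∫⁻ _, ENNReal.ofReal c ∂μ := by
        refine lintegral_mono fun ω => ?_
        have h := ENNReal.ofReal_le_ofReal (card_upperRank_le (T ω) hc)
        rw [ENNReal.ofReal_natCast] at h
        simpa [Set.indicator_apply, Finset.sum_boole] using h
    _ = ENNReal.ofReal c := by simp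

/-- **Validity of the Monte Carlo rank-based p-value from exchangeability.**
If `(T_0, …, T_M)` is an exchangeable random vector of real random variables, then the
p-value `P = (1 + #{m ∈ {1,…,M} : T_m ≥ T_0})/(1 + M)` satisfies `ℙ{P ≤ α} ≤ α` for
every `α ∈ [0,1]`. -/
theorem exchangeable_rank_p_value_valid
    {Ω : Type*} [MeasurableSpace Ω] (μ : Measure Ω) [IsProbabilityMeasure μ]
    (M : ℕ) (T : Ω → Fin (M + 1) → ℝ) (hT : Measurable T)
    (hexch : ∀ π : Equiv.Perm (Fin (M + 1)),
      Measure.map (fun ω => fun m => T ω (π m)) μ = Measure.map T μ)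
    (Pval : Ω → ℝ)
    (hP : ∀ ω, Pval ω =
      (1 + ((Finset.univ.filter (fun m : Fin M => T ω 0 ≤ T ω m.succ)).card : ℝ)) / (1 + M)) :
    ∀ α ∈ Set.Icc (0 : ℝ) 1, μ {ω | Pval ω ≤ α} ≤ ENNReal.ofReal α := by
  rintro α ⟨hα, -⟩
  have hset : {ω | Pval ω ≤ α} = {ω | (upperRank (T ω) 0 : ℝ) ≤ ((M + 1 : ℕ) : ℝ) * α} := by
    ext ω
    have hM : (0 : ℝ) < 1 + M := by positivity
    simp only [Set.mem_ofPred_eq, hP, upperRank_zero, div_le_iff₀ hM]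
    push_cast
    rw [mul_comm α, add_comm (M : ℝ)]
  have h := card_mul_measure_upperRank_le μ hT hexch 0
    (mul_nonneg (Nat.cast_nonneg (M + 1)) hα)
  rw [Fintype.card_fin, ENNReal.ofReal_mul (Nat.cast_nonneg _), ENNReal.ofReal_natCast,
    ← hset] at h
  exact (ENNReal.mul_le_mul_iff_right (by simp) (ENNReal.natCast_ne_top _)).1 h
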